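/- Let k be a field of characteristic 0, g ≥ 1, and let e₁, …, e_g and f₁, …, f_g be positive integers. Set M = k[x₁, …, x_g]/(x₁^{e₁}, …, x_g^{e_g}) and M' = k[x₁, …, x_g]/(x₁^{f₁}, …, x_g^{f_g}), and let M * M' denote their Pontryagin product, i.e., the k-vector space M ⊗_k M' regarded as a module over k[t₁, …, t_g] where t_i acts by t_i·(m ⊗ m') = (x_i m) ⊗ m' + m ⊗ (x_i m'). Set ε_i = min(e_i, f_i). Then M * M' is isomorphic as a k[t₁, …, t_g]-module to the direct sum, over all multi-indices I = (i₁, …, i_g) with 0 ≤ i_j ≤ ε_j − 1, of k[t₁, …, t_g]/(t₁^{e₁+f₁−1−2i₁}, …, t_g^{e_g+f_g−1−2i_g}). -/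

import Mathlib

set_option synthInstance.maxHeartbeats 1000000
set_option maxHeartbeats 1000000

open MvPolynomial TensorProduct

/-- The Pontryagin product module structure of `k[t₁,…,t_g]` on `M ⊗_k M'`, where
`t_i` acts as `x_i ⊗ 1 + 1 ⊗ x_i`, i.e. `t_i • (m ⊗ m') = (x_i m) ⊗ m' + m ⊗ (x_i m')`. -/
noncomputable instance (priority := 5000) pontModule
    (k : Type*) [CommRing k] (g : ℕ) (e f : Fin g → ℕ) :
    Module (MvPolynomial (Fin g) k)
      ((MvPolynomial (Fin g) k ⧸
          Ideal.span (Set.range fun i : Fin g => (X i : MvPolynomial (Fin g) k) ^ e i)) ⊗[k]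
        (MvPolynomial (Fin g) k ⧸
          Ideal.span (Set.range fun i : Fin g => (X i : MvPolynomial (Fin g) k) ^ f i))) :=
  Module.compHom _
    (MvPolynomial.aeval fun i : Fin g =>
      Ideal.Quotient.mk
          (Ideal.span (Set.range fun i : Fin g => (X i : MvPolynomial (Fin g) k) ^ e i))
          (X i) ⊗ₜ[k] 1 +
        1 ⊗ₜ[k]
          Ideal.Quotient.mk
            (Ideal.span (Set.range fun i : Fin g => (X i : MvPolynomial (Fin g) k) ^ f i))
            (X i)).toRingHom

theorem alternating_sum_choose_mul_descFactorial (k : Type*) [CommRing k] [IsDomain k] (i a m : ℕ)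
    (hm : m < i) :
    ∑ j ∈ Finset.range (i + 1),
      (-1 : k) ^ (i - j) * (i.choose j : k) * ((a + j).descFactorial m : k) = 0 := by
  have hdeg : ((descPochhammer k m).comp (Polynomial.X + Polynomial.C (a : k))).natDegree < i := by
    rw [Polynomial.natDegree_comp, Polynomial.natDegree_X_add_C, mul_one, descPochhammer_natDegree]
    exact hm
  have h := congrFun (Polynomial.fwdDiff_iter_eq_zero_of_degree_lt hdeg) 0
  rw [fwdDiff_iter_eq_sum_shift] at h
  rw [← Pi.zero_apply (M := fun _ : k => k) 0, ← h]
  refine Finset.sum_congr rfl fun j _ => ?_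
  have heval : ((descPochhammer k m).comp (Polynomial.X + Polynomial.C (a : k))).eval
      (0 + j • 1 : k) = ((a + j).descFactorial m : k) := by
    rw [← descPochhammer_eval_eq_descFactorial, Polynomial.eval_comp]
    simp [add_comm]
  rw [heval]
  simp

/-- The coefficients, up to homogenization, of the iterated primitive of
`w ^ (e - 1 - i) * (w - 1) ^ i` vanishing to high order at `0`. -/
noncomputable def lowestWeightCoeff (k : Type*) [Field k] (e f i j : ℕ) : k :=
  (-1) ^ (i - j) * (i.choose j : k) * ((e - 1 - i + j).factorial : k) /
    ((e + f - 1 - 2 * i + j).factorial : k)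

/-- The generator of degree `i` of `k[x]/(x ^ e) ⊗ k[y]/(y ^ f)` as a module over `k[x + y]`. -/
noncomputable def lowestWeightVector (k : Type*) [Field k] {S : Type*} [CommRing S] [Algebra k S]
    (x y : S) (e f i : ℕ) : S :=
  ∑ j ∈ Finset.range (i + 1), lowestWeightCoeff k e f i j • ((x + y) ^ j * x ^ (i - j))

theorem sum_lowestWeightCoeff_mul_choose (k : Type*) [Field k] [CharZero k] {e f i b : ℕ}
    (hi : i < min e f) (hb : f ≤ b + i) (hb' : b < f) :
    ∑ j ∈ Finset.range (i + 1),
      lowestWeightCoeff k e f i j * ((e + f - 1 - 2 * i + j).choose b : k) = 0 := by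
  have h := alternating_sum_choose_mul_descFactorial k i (e - 1 - i) (b + i - f) (by omega)
  have hfac (n : ℕ) : (n.factorial : k) ≠ 0 := Nat.cast_ne_zero.mpr n.factorial_ne_zero
  have key (j : ℕ) : lowestWeightCoeff k e f i j * ((e + f - 1 - 2 * i + j).choose b : k) =
      (b.factorial : k)⁻¹ * ((-1 : k) ^ (i - j) * (i.choose j : k) *
        ((e - 1 - i + j).descFactorial (b + i - f) : k)) := by
    rw [lowestWeightCoeff]
    rcases lt_or_ge (e + f - 1 - 2 * i + j) b with hlt | hle
    · rw [Nat.choose_eq_zero_of_lt hlt, Nat.descFactorial_eq_zero_iff_lt.mpr (by omega)]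
      simp
    · have h1 := Nat.choose_mul_factorial_mul_factorial hle
      have h2 := Nat.factorial_mul_descFactorial (n := e - 1 - i + j) (k := b + i - f) (by omega)
      have h3 : e - 1 - i + j - (b + i - f) = e + f - 1 - 2 * i + j - b := by omega
      rw [h3] at h2
      have h1' := congrArg (Nat.cast (R := k)) h1
      have h2' := congrArg (Nat.cast (R := k)) h2
      push_cast at h1' h2'
      rw [← h2', ← h1']
      have := hfac b
      have := hfac (e + f - 1 - 2 * i + j - b)
      have : ((e + f - 1 - 2 * i + j).choose b : k) ≠ 0 :=
        Nat.cast_ne_zero.mpr (Nat.choose_pos hle).ne'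
      field_simp
  simp_rw [key, ← Finset.mul_sum, h, mul_zero]

section OneVariable

variable {k : Type*} [Field k] [CharZero k] {S : Type*} [CommRing S] [Algebra k S]
  {x y : S} {e f : ℕ}

theorem add_pow_mul_lowestWeightVector (hx : x ^ e = 0) (hy : y ^ f = 0) {i : ℕ}
    (hi : i < min e f) :
    (x + y) ^ (e + f - 1 - 2 * i) * lowestWeightVector k x y e f i = 0 := by
  set d := e + f - 1 - 2 * i with hd
  have expand (j : ℕ) (hj : j ∈ Finset.range (i + 1)) :
      (x + y) ^ d * (lowestWeightCoeff k e f i j • ((x + y) ^ j * x ^ (i - j))) =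
        ∑ b ∈ Finset.range (d + i + 1),
          (lowestWeightCoeff k e f i j * ((d + j).choose b : k)) • (x ^ (d + i - b) * y ^ b) := by
    have hj' : j ≤ i := Nat.lt_succ_iff.mp (Finset.mem_range.mp hj)
    rw [mul_smul_comm, ← mul_assoc, ← pow_add, add_comm x y, add_pow, Finset.sum_mul,
      Finset.smul_sum]
    refine Eq.trans ?_ (Finset.sum_subset (s₁ := Finset.range (d + j + 1))
      (Finset.range_subset_range.mpr (by omega)) ?_)
    · refine Finset.sum_congr rfl fun b hb => ?_
      have hb' : b ≤ d + j := Nat.lt_succ_iff.mp (Finset.mem_range.mp hb)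
      rw [mul_smul, Nat.cast_smul_eq_nsmul, nsmul_eq_mul,
        show d + i - b = (d + j - b) + (i - j) by omega, pow_add]
      congr 1
      ring
    · intro b _ hb
      rw [Nat.choose_eq_zero_of_lt (by simpa using hb)]
      simp
  rw [lowestWeightVector, Finset.mul_sum, Finset.sum_congr rfl expand, Finset.sum_comm]
  refine Finset.sum_eq_zero fun b _ => ?_
  rw [← Finset.sum_smul]
  rcases le_or_gt f b with hfb | hbf
  · rw [pow_eq_zero_of_le hfb hy, mul_zero, smul_zero]
  rcases le_or_gt f (b + i) with hfb | hbf'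
  · rw [sum_lowestWeightCoeff_mul_choose k hi hfb hbf, zero_smul]
  · rw [pow_eq_zero_of_le (by omega) hx, zero_mul, smul_zero]

theorem pow_mul_pow_mem_of_lowestWeightVector_mem (hx : x ^ e = 0) (hy : y ^ f = 0)
    (N : Submodule k S) (ht : ∀ s ∈ N, (x + y) * s ∈ N)
    (hv : ∀ i < min e f, lowestWeightVector k x y e f i ∈ N) (a b : ℕ) :
    x ^ a * y ^ b ∈ N := by
  have htpow (n : ℕ) {s : S} (hs : s ∈ N) : (x + y) ^ n * s ∈ N := by
    induction n with
    | zero => simpa using hs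
    | succ n ih => rw [pow_succ', mul_assoc]; exact ht _ ih
  have hxpow (a : ℕ) : x ^ a ∈ N := by
    induction a using Nat.strong_induction_on with
    | _ a ih =>
    rcases lt_or_ge a (min e f) with ha | ha
    · have h := hv a ha
      rw [lowestWeightVector, Finset.sum_range_succ'] at h
      have hsum : ∑ j ∈ Finset.range a, lowestWeightCoeff k e f a (j + 1) •
          ((x + y) ^ (j + 1) * x ^ (a - (j + 1))) ∈ N :=
        N.sum_mem fun j hj => N.smul_mem _ (htpow _ (ih _ (by
          have := Finset.mem_range.mp hj
          omega)))
      have h0 := (N.add_mem_iff_right hsum).mp h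
      have hc : lowestWeightCoeff k e f a 0 ≠ 0 := by
        simp [lowestWeightCoeff, Nat.factorial_ne_zero]
      simpa using (N.smul_mem_iff hc).mp h0
    · rcases le_or_gt e a with hea | hae
      · rw [pow_eq_zero_of_le hea hx]
        exact N.zero_mem
      have hfa : f ≤ a := by omega
      have hpow : (x + -(x + y)) ^ f = 0 := by
        rw [show x + -(x + y) = -y by ring, neg_pow, hy, mul_zero]
      rw [add_pow, Finset.sum_range_succ, Nat.sub_self, pow_zero, mul_one, Nat.choose_self,
        Nat.cast_one, mul_one] at hpow
      have hxf : x ^ a = -∑ m ∈ Finset.range f,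
          ((-1 : k) ^ (f - m) * (f.choose m : k)) • ((x + y) ^ (f - m) * x ^ (m + (a - f))) := by
        have hxa : x ^ a = x ^ f * x ^ (a - f) := by rw [← pow_add, Nat.add_sub_cancel' hfa]
        rw [hxa, eq_neg_of_add_eq_zero_right hpow, neg_mul, Finset.sum_mul]
        congr 1
        refine Finset.sum_congr rfl fun m _ => ?_
        rw [Algebra.smul_def, neg_pow (x + y), pow_add]
        simp only [map_mul, map_pow, map_neg, map_one, map_natCast]
        ring
      rw [hxf]
      refine N.neg_mem (N.sum_mem fun m hm => N.smul_mem _ (htpow _ (ih _ ?_)))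
      have := Finset.mem_range.mp hm
      omega
  induction b generalizing a with
  | zero => simpa using hxpow a
  | succ b ih =>
    rw [show x ^ a * y ^ (b + 1) = (x + y) * (x ^ a * y ^ b) - x ^ (a + 1) * y ^ b by ring]
    exact N.sub_mem (ht _ (ih a)) (ih (a + 1))

end OneVariable

section MonomialQuotient

variable (k : Type*) [Field k] {σ : Type*} [Fintype σ]

/-- The coefficients of the monomials outside of the ideal generated by the `X i ^ e i`. -/
noncomputable def coeffBelow (e : σ → ℕ) : MvPolynomial σ k →ₗ[k] (((i : σ) → Fin (e i)) → k) :=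
  LinearMap.pi fun a => MvPolynomial.lcoeff k (Finsupp.equivFunOnFinite.symm fun i => (a i : ℕ))

theorem coeffBelow_surjective (e : σ → ℕ) : Function.Surjective (coeffBelow k e) := by
  classical
  intro c
  refine ⟨∑ a, monomial (Finsupp.equivFunOnFinite.symm fun i => (a i : ℕ)) (c a), ?_⟩
  ext b
  have hinj (a : (i : σ) → Fin (e i)) :
      (Finsupp.equivFunOnFinite.symm fun i => (a i : ℕ)) =
        Finsupp.equivFunOnFinite.symm (fun i => (b i : ℕ)) ↔ a = b := by
    rw [Equiv.apply_eq_iff_eq]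
    exact ⟨fun h => funext fun i => Fin.ext (congrFun h i), fun h => h ▸ rfl⟩
  simp [coeffBelow, coeff_monomial, hinj]

theorem ker_coeffBelow (e : σ → ℕ) :
    LinearMap.ker (coeffBelow k e) =
      (Ideal.span (Set.range fun i => (X i : MvPolynomial σ k) ^ e i)).restrictScalars k := by
  have hspan : (Set.range fun i => (X i : MvPolynomial σ k) ^ e i) =
      (fun s => monomial s (1 : k)) '' Set.range fun i => Finsupp.single i (e i) := by
    rw [← Set.range_comp]
    simp only [X_pow_eq_monomial, Function.comp_def]
  ext p
  rw [Submodule.restrictScalars_mem, hspan, mem_ideal_span_monomial_image, LinearMap.mem_ker]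
  simp only [Set.exists_range_iff, Finsupp.single_le_iff]
  constructor
  · intro h m hm
    by_contra! hlt
    refine mem_support_iff.mp hm ?_
    have := congrFun h fun i => ⟨m i, hlt i⟩
    simpa [coeffBelow] using this
  · intro h
    ext a
    by_contra hne
    obtain ⟨i, hi⟩ := h (Finsupp.equivFunOnFinite.symm fun i => (a i : ℕ))
      (mem_support_iff.mpr (by simpa [coeffBelow] using hne))
    exact absurd hi (by simp)

/-- The classes of the monomials `∏ i, X i ^ a i` with `a i < e i` are a basis. -/
noncomputable def quotientSpanXPowEquiv (e : σ → ℕ) :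
    (MvPolynomial σ k ⧸ Ideal.span (Set.range fun i => (X i : MvPolynomial σ k) ^ e i)) ≃ₗ[k]
      (((i : σ) → Fin (e i)) → k) :=
  (Submodule.Quotient.restrictScalarsEquiv k _).symm ≪≫ₗ
    Submodule.quotEquivOfEq _ _ (ker_coeffBelow k e).symm ≪≫ₗ
    (coeffBelow k e).quotKerEquivOfSurjective (coeffBelow_surjective k e)

instance finite_quotient_span_X_pow (e : σ → ℕ) : Module.Finite k
    (MvPolynomial σ k ⧸ Ideal.span (Set.range fun i => (X i : MvPolynomial σ k) ^ e i)) :=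
  Module.Finite.equiv (quotientSpanXPowEquiv k e).symm

theorem finrank_quotient_span_X_pow (e : σ → ℕ) : Module.finrank k
    (MvPolynomial σ k ⧸ Ideal.span (Set.range fun i => (X i : MvPolynomial σ k) ^ e i)) =
      ∏ i, e i := by
  classical
  rw [(quotientSpanXPowEquiv k e).finrank_eq, Module.finrank_fintype_fun_eq_card]
  simp

end MonomialQuotient

theorem sum_add_sub_one_sub_two_mul (a b : ℕ) :
    ∑ i : Fin (min a b), (a + b - 1 - 2 * (i : ℕ)) = a * b := by
  rw [Fin.sum_univ_eq_sum_range fun i => a + b - 1 - 2 * i]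
  have key (m : ℕ) (hm : m ≤ min a b) :
      ∑ i ∈ Finset.range m, (a + b - 1 - 2 * i) + m * m = m * (a + b) := by
    induction m with
    | zero => simp
    | succ m ih =>
      rw [Finset.sum_range_succ]
      have h := ih (by omega)
      have : a + b - 1 - 2 * m + (2 * m + 1) = a + b := by omega
      linear_combination h + this
  have h := key _ le_rfl
  rcases le_total a b with hab | hab
  · rw [min_eq_left hab] at h ⊢
    linarith
  · rw [min_eq_right hab] at h ⊢
    linarith

theorem sum_prod_add_sub_one_sub_two_mul {σ : Type*} [Fintype σ] [DecidableEq σ] (e f : σ → ℕ) :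
    ∑ I : (j : σ) → Fin (min (e j) (f j)), ∏ j, (e j + f j - 1 - 2 * (I j : ℕ)) =
      (∏ j, e j) * ∏ j, f j := by
  rw [← Finset.prod_mul_distrib,
    ← Finset.prod_congr rfl fun j _ => sum_add_sub_one_sub_two_mul (e j) (f j),
    Finset.prod_univ_sum, Fintype.piFinset_univ]

section Decomposition

variable {k : Type*} [Field k] [CharZero k] {σ : Type*} [Fintype σ] [DecidableEq σ]
  {S : Type*} [CommRing S] [Algebra k S] [Module (MvPolynomial σ k) S] {x y : σ → S} {e f : σ → ℕ}

theorem prod_mem_span_prod_lowestWeightVector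
    (hsmul : ∀ (p : MvPolynomial σ k) (s : S), p • s = aeval (fun j => x j + y j) p * s)
    (hx : ∀ j, x j ^ e j = 0) (hy : ∀ j, y j ^ f j = 0) (a b : σ → ℕ) :
    ∏ j, (x j ^ a j * y j ^ b j) ∈
      Submodule.span (MvPolynomial σ k) (Set.range fun I : (j : σ) → Fin (min (e j) (f j)) =>
        ∏ j, lowestWeightVector k (x j) (y j) (e j) (f j) (I j)) := by
  have : IsScalarTower k (MvPolynomial σ k) S :=
    ⟨fun c p s => by simp only [hsmul, map_smul, smul_mul_assoc]⟩
  have hmem (j : σ) : ∃ p : Fin (min (e j) (f j)) → MvPolynomial σ k,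
      ∑ i, p i • lowestWeightVector k (x j) (y j) (e j) (f j) i = x j ^ a j * y j ^ b j := by
    rw [← Submodule.mem_span_range_iff_exists_fun]
    refine pow_mul_pow_mem_of_lowestWeightVector_mem (k := k) (hx j) (hy j)
      ((Submodule.span (MvPolynomial σ k) (Set.range fun i : Fin (min (e j) (f j)) =>
        lowestWeightVector k (x j) (y j) (e j) (f j) i)).restrictScalars k) ?_ ?_ (a j) (b j)
    · intro s hs
      have h := Submodule.smul_mem _ (X j : MvPolynomial σ k) hs
      rwa [hsmul, aeval_X] at h
    · exact fun i hi => Submodule.subset_span ⟨⟨i, hi⟩, rfl⟩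
  choose p hp using hmem
  simp_rw [← hp, hsmul, Finset.prod_univ_sum, Finset.prod_mul_distrib, ← map_prod, ← hsmul]
  exact Submodule.sum_mem _ fun I _ => Submodule.smul_mem _ _ (Submodule.subset_span ⟨I, rfl⟩)

theorem span_prod_lowestWeightVector_eq_top
    (hsmul : ∀ (p : MvPolynomial σ k) (s : S), p • s = aeval (fun j => x j + y j) p * s)
    (hx : ∀ j, x j ^ e j = 0) (hy : ∀ j, y j ^ f j = 0)
    (hxy : Function.Surjective (aeval (Sum.elim x y) : MvPolynomial (σ ⊕ σ) k →ₐ[k] S)) :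
    Submodule.span (MvPolynomial σ k) (Set.range fun I : (j : σ) → Fin (min (e j) (f j)) =>
      ∏ j, lowestWeightVector k (x j) (y j) (e j) (f j) (I j)) = ⊤ := by
  rw [eq_top_iff]
  rintro s -
  obtain ⟨p, rfl⟩ := hxy s
  induction p using MvPolynomial.induction_on' with
  | monomial m c =>
    have h := Submodule.smul_mem _ (C c : MvPolynomial σ k) (prod_mem_span_prod_lowestWeightVector
      hsmul hx hy (fun j => m (Sum.inl j)) fun j => m (Sum.inr j))
    rw [hsmul, aeval_C] at h
    rw [aeval_monomial, Finsupp.prod_fintype _ _ fun _ => pow_zero _, Fintype.prod_sum_type]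
    simpa [Finset.prod_mul_distrib] using h
  | add p q hp hq => simpa using Submodule.add_mem _ hp hq

theorem span_X_pow_le_ker_toSpanSingleton
    (hsmul : ∀ (p : MvPolynomial σ k) (s : S), p • s = aeval (fun j => x j + y j) p * s)
    (hx : ∀ j, x j ^ e j = 0) (hy : ∀ j, y j ^ f j = 0) (I : (j : σ) → Fin (min (e j) (f j))) :
    Ideal.span (Set.range fun j =>
        (X j : MvPolynomial σ k) ^ (e j + f j - 1 - 2 * (I j : ℕ))) ≤
      LinearMap.ker (LinearMap.toSpanSingleton (MvPolynomial σ k) S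
        (∏ j, lowestWeightVector k (x j) (y j) (e j) (f j) (I j))) := by
  rw [Ideal.span_le]
  rintro _ ⟨j, rfl⟩
  simp only [SetLike.mem_coe, LinearMap.mem_ker, LinearMap.toSpanSingleton_apply, hsmul, map_pow,
    aeval_X]
  rw [← Finset.mul_prod_erase _ _ (Finset.mem_univ j), ← mul_assoc,
    add_pow_mul_lowestWeightVector (hx j) (hy j) (I j).2, zero_mul]

/-- A `k`-algebra generated by elements `x j`, `y j` with `x j ^ e j = 0` and `y j ^ f j = 0`, of the
largest dimension these relations allow, decomposes over the polynomial ring acting through the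
elements `x j + y j`. -/
theorem nonempty_linearEquiv_pi_quotient_span_X_pow [Module.Finite k S]
    (hsmul : ∀ (p : MvPolynomial σ k) (s : S), p • s = aeval (fun j => x j + y j) p * s)
    (hx : ∀ j, x j ^ e j = 0) (hy : ∀ j, y j ^ f j = 0)
    (hxy : Function.Surjective (aeval (Sum.elim x y) : MvPolynomial (σ ⊕ σ) k →ₐ[k] S))
    (hdim : Module.finrank k S = (∏ j, e j) * ∏ j, f j) :
    Nonempty (S ≃ₗ[MvPolynomial σ k] ((I : (j : σ) → Fin (min (e j) (f j))) →
      MvPolynomial σ k ⧸ Ideal.span (Set.range fun j =>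
        (X j : MvPolynomial σ k) ^ (e j + f j - 1 - 2 * (I j : ℕ))))) := by
  have : IsScalarTower k (MvPolynomial σ k) S :=
    ⟨fun c p s => by simp only [hsmul, map_smul, smul_mul_assoc]⟩
  let Φ := LinearMap.lsum (MvPolynomial σ k) (fun I : (j : σ) → Fin (min (e j) (f j)) =>
      MvPolynomial σ k ⧸ Ideal.span (Set.range fun j =>
        (X j : MvPolynomial σ k) ^ (e j + f j - 1 - 2 * (I j : ℕ)))) (MvPolynomial σ k)
    fun I => Submodule.liftQ _ _ (span_X_pow_le_ker_toSpanSingleton hsmul hx hy I)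
  have hsurj : Function.Surjective Φ := by
    rw [← LinearMap.range_eq_top, eq_top_iff, ← span_prod_lowestWeightVector_eq_top hsmul hx hy hxy,
      Submodule.span_le]
    rintro _ ⟨I, rfl⟩
    refine ⟨Pi.single I (Submodule.Quotient.mk 1), ?_⟩
    rw [LinearMap.lsum_piSingle, Submodule.liftQ_apply, LinearMap.toSpanSingleton_apply, one_smul]
  have hinj : Function.Injective Φ := by
    refine (LinearMap.injective_iff_surjective_of_finrank_eq_finrank
      (f := Φ.restrictScalars k) ?_).mpr hsurj
    rw [hdim, Module.finrank_pi_fintype, ← sum_prod_add_sub_one_sub_two_mul]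
    exact Finset.sum_congr rfl fun I _ => finrank_quotient_span_X_pow k _
  exact ⟨(LinearEquiv.ofBijective Φ ⟨hinj, hsurj⟩).symm⟩

end Decomposition

theorem aeval_tmul_surjective {k σ : Type*} [Field k] (I J : Ideal (MvPolynomial σ k)) :
    Function.Surjective (aeval (Sum.elim
        (fun i => Ideal.Quotient.mk I (X i) ⊗ₜ[k] (1 : MvPolynomial σ k ⧸ J))
        fun i => (1 : MvPolynomial σ k ⧸ I) ⊗ₜ[k] Ideal.Quotient.mk J (X i)) :
      MvPolynomial (σ ⊕ σ) k →ₐ[k] (MvPolynomial σ k ⧸ I) ⊗[k] (MvPolynomial σ k ⧸ J)) := by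
  set φ : MvPolynomial (σ ⊕ σ) k →ₐ[k] (MvPolynomial σ k ⧸ I) ⊗[k] (MvPolynomial σ k ⧸ J) :=
    aeval (Sum.elim (fun i => Ideal.Quotient.mk I (X i) ⊗ₜ[k] 1)
      fun i => 1 ⊗ₜ[k] Ideal.Quotient.mk J (X i)) with hφ
  have hl : φ.comp (rename Sum.inl) =
      (Algebra.TensorProduct.includeLeft).comp (Ideal.Quotient.mkₐ k I) := by
    ext i
    simp [hφ]
  have hr : φ.comp (rename Sum.inr) =
      (Algebra.TensorProduct.includeRight).comp (Ideal.Quotient.mkₐ k J) := by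
    ext i
    simp [hφ]
  intro s
  induction s using TensorProduct.induction_on with
  | zero => exact ⟨0, map_zero _⟩
  | add s t hs ht =>
    obtain ⟨p, rfl⟩ := hs
    obtain ⟨q, rfl⟩ := ht
    exact ⟨p + q, map_add _ _ _⟩
  | tmul m n =>
    obtain ⟨p, rfl⟩ := Ideal.Quotient.mk_surjective m
    obtain ⟨q, rfl⟩ := Ideal.Quotient.mk_surjective n
    refine ⟨rename Sum.inl p * rename Sum.inr q, ?_⟩
    have h1 := DFunLike.congr_fun hl p
    have h2 := DFunLike.congr_fun hr q
    simp only [AlgHom.comp_apply] at h1 h2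
    rw [map_mul, h1, h2]
    simp

theorem pontModule_smul_def (k : Type*) [Field k] (g : ℕ) (e f : Fin g → ℕ)
    (p : MvPolynomial (Fin g) k)
    (s : (MvPolynomial (Fin g) k ⧸
          Ideal.span (Set.range fun i : Fin g => (X i : MvPolynomial (Fin g) k) ^ e i)) ⊗[k]
        (MvPolynomial (Fin g) k ⧸
          Ideal.span (Set.range fun i : Fin g => (X i : MvPolynomial (Fin g) k) ^ f i))) :
    (pontModule k g e f).toSMul.smul p s =
      aeval (fun i => Ideal.Quotient.mk _ (X i) ⊗ₜ[k] 1 + 1 ⊗ₜ[k] Ideal.Quotient.mk _ (X i)) p * s :=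
  rfl

/-- Let `k` be a field of characteristic `0`, `g ≥ 1`, and `e_i, f_i` positive integers.
Let `M = k[x₁,…,x_g]/(x₁^{e₁},…,x_g^{e_g})`, `M' = k[x₁,…,x_g]/(x₁^{f₁},…,x_g^{f_g})`, and
let `M * M'` be their Pontryagin product, i.e. `M ⊗_k M'` as a `k[t₁,…,t_g]`-module with
`t_i • (m ⊗ m') = (x_i m) ⊗ m' + m ⊗ (x_i m')`.  Then, with `ε_i = min (e_i, f_i)`,
`M * M'` is isomorphic as a `k[t₁,…,t_g]`-module to the direct sum over all multi-indices
`I` with `0 ≤ i_j ≤ ε_j - 1` of `k[t₁,…,t_g]/(t₁^{e₁+f₁-1-2i₁},…,t_g^{e_g+f_g-1-2i_g})`. -/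
theorem pontryagin_product_decomposition
    (k : Type*) [Field k] [CharZero k] (g : ℕ) (hg : 1 ≤ g)
    (e f : Fin g → ℕ) (he : ∀ i, 0 < e i) (hf : ∀ i, 0 < f i) :
    Nonempty
      (((MvPolynomial (Fin g) k ⧸
          Ideal.span (Set.range fun i : Fin g => (X i : MvPolynomial (Fin g) k) ^ e i)) ⊗[k]
        (MvPolynomial (Fin g) k ⧸
          Ideal.span (Set.range fun i : Fin g => (X i : MvPolynomial (Fin g) k) ^ f i)))
        ≃ₗ[MvPolynomial (Fin g) k]
      ((I : (j : Fin g) → Fin (min (e j) (f j))) →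
        MvPolynomial (Fin g) k ⧸
          Ideal.span (Set.range fun j : Fin g =>
            (X j : MvPolynomial (Fin g) k) ^ (e j + f j - 1 - 2 * ((I j : ℕ)))))) := by
  have hmk (a : Fin g → ℕ) (j : Fin g) :
      Ideal.Quotient.mk (Ideal.span (Set.range fun i => (X i : MvPolynomial (Fin g) k) ^ a i))
        (X j) ^ a j = 0 := by
    rw [← map_pow, Ideal.Quotient.eq_zero_iff_mem]
    exact Ideal.subset_span ⟨j, rfl⟩
  have hx (j : Fin g) :
      (Ideal.Quotient.mk (Ideal.span (Set.range fun i => (X i : MvPolynomial (Fin g) k) ^ e i))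
        (X j) ⊗ₜ[k] (1 : MvPolynomial (Fin g) k ⧸
          Ideal.span (Set.range fun i => (X i : MvPolynomial (Fin g) k) ^ f i))) ^ e j = 0 := by
    rw [Algebra.TensorProduct.tmul_pow, hmk, TensorProduct.zero_tmul]
  have hy (j : Fin g) :
      ((1 : MvPolynomial (Fin g) k ⧸
          Ideal.span (Set.range fun i => (X i : MvPolynomial (Fin g) k) ^ e i)) ⊗ₜ[k]
        Ideal.Quotient.mk (Ideal.span (Set.range fun i => (X i : MvPolynomial (Fin g) k) ^ f i))
          (X j)) ^ f j = 0 := by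
    rw [Algebra.TensorProduct.tmul_pow, hmk, TensorProduct.tmul_zero]
  have hdim := Module.finrank_tensorProduct (R := k) (S := k)
    (M := MvPolynomial (Fin g) k ⧸
      Ideal.span (Set.range fun i => (X i : MvPolynomial (Fin g) k) ^ e i))
    (M' := MvPolynomial (Fin g) k ⧸
      Ideal.span (Set.range fun i => (X i : MvPolynomial (Fin g) k) ^ f i))
  rw [finrank_quotient_span_X_pow, finrank_quotient_span_X_pow] at hdim
  have hfin := Module.Finite.tensorProduct k
    (MvPolynomial (Fin g) k ⧸
      Ideal.span (Set.range fun i => (X i : MvPolynomial (Fin g) k) ^ e i))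
    (MvPolynomial (Fin g) k ⧸
      Ideal.span (Set.range fun i => (X i : MvPolynomial (Fin g) k) ^ f i))
  exact @nonempty_linearEquiv_pi_quotient_span_X_pow k _ _ (Fin g) _ _
    ((MvPolynomial (Fin g) k ⧸
        Ideal.span (Set.range fun i => (X i : MvPolynomial (Fin g) k) ^ e i)) ⊗[k]
      (MvPolynomial (Fin g) k ⧸
        Ideal.span (Set.range fun i => (X i : MvPolynomial (Fin g) k) ^ f i)))
    _ _ (pontModule k g e f) (fun i => Ideal.Quotient.mk _ (X i) ⊗ₜ[k] 1)
    (fun i => 1 ⊗ₜ[k] Ideal.Quotient.mk _ (X i)) e f hfin (pontModule_smul_def k g e f) hx hy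
    (aeval_tmul_surjective _ _) hdim
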